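/- Let (Xₙ) be a Markov chain on ℤ₊ satisfying: (i) there exist ε > 0 and M < ∞ with E_i{X₁ − i; X₁ − i ≤ M} ≥ ε for all i ∈ ℤ₊ (uniform truncated positive drift); (ii) there exists a nonnegative random variable ζ with Eζ < ∞ such that P_i{X₁ − i ≤ −j} ≤ P{ζ ≥ j} for all i, j ∈ ℤ₊ (uniformly integrable downward tails). Then there exists γ > 0 with sup_{i∈ℤ₊} E_i e^{γ ℓ(i)} < ∞. -/

import Mathlib

open MeasureTheory Filter Topology
open scoped ENNReal NNReal

structure MC where
  μ : ℕ → Measure (ℕ → ℕ)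
  prob : ∀ i, IsProbabilityMeasure (μ i)
  start : ∀ i, μ i {ω | ω 0 = i} = 1
  P : ℕ → ℕ → ℝ≥0∞
  P_sum : ∀ i, ∑' j, P i j = 1
  markov : ∀ i, (μ i).map (fun ω n => ω (n + 1)) = Measure.sum fun j => P i j • μ j

noncomputable def qt (Q : ℕ → ℕ → ℝ≥0∞) (i : ℕ) : ℝ≥0∞ := ∑' j, Q i j

noncomputable def fQ (Q : ℕ → ℕ → ℝ≥0∞) (X : MC) (i : ℕ) : ℝ≥0∞ :=
  ∫⁻ ω, ∏' n, qt Q (ω n) ∂(X.μ i)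

def condC (Q : ℕ → ℕ → ℝ≥0∞) (X : MC) : Prop :=
  ∀ i, (∫⁻ ω, ∏' n, max (qt Q (ω n)) 1 ∂(X.μ i)) < ∞

noncomputable def Qpow (Q : ℕ → ℕ → ℝ≥0∞) : ℕ → ℕ → ℕ → ℝ≥0∞
  | 0 => fun i j => if i = j then 1 else 0
  | n + 1 => fun i j => ∑' k, Q i k * Qpow Q n k j

def Irred (Q : ℕ → ℕ → ℝ≥0∞) : Prop := ∀ i j, ∃ n, 0 < Qpow Q n i j

noncomputable def locTime (j : ℕ) (ω : ℕ → ℕ) : ℝ≥0∞ := ∑' n, if ω n = j then 1 else 0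

noncomputable def locExp (γ : ℝ) (j : ℕ) (ω : ℕ → ℕ) : ℝ≥0∞ :=
  ∏' n, if ω n = j then ENNReal.ofReal (Real.exp γ) else 1

noncomputable def deltaQ (Q : ℕ → ℕ → ℝ≥0∞) (j : ℕ) : ℝ := Real.log (qt Q j).toReal

noncomputable def jumpP (X : MC) (i : ℕ) (j : ℤ) : ℝ≥0∞ :=
  if 0 ≤ (i : ℤ) + j then X.P i ((i : ℤ) + j).toNat else 0

/-- Solution of the renewal-type recursion. -/
noncomputable def uSeq (c : ℝ) (q : ℕ → ℝ) : ℕ → ℝ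
  | 0 => 1
  | n + 1 => c * ∑ j : Fin (n + 1), uSeq c q (n - j) * q (j + 1)

lemma uSeq_succ (c : ℝ) (q : ℕ → ℝ) (n : ℕ) :
    uSeq c q (n + 1) = c * ∑ j ∈ Finset.range (n + 1), uSeq c q (n - j) * q (j + 1) := by
  rw [uSeq, Finset.sum_range]

lemma uSeq_zero (c : ℝ) (q : ℕ → ℝ) : uSeq c q 0 = 1 := by rw [uSeq]

lemma uSeq_nonneg (c : ℝ) (hc : 0 ≤ c) (q : ℕ → ℝ) (hq : ∀ n, 0 ≤ q n) (n : ℕ) :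
    0 ≤ uSeq c q n := by
  induction n using Nat.strong_induction_on with
  | _ n ih =>
    cases n with
    | zero => rw [uSeq_zero]; norm_num
    | succ n =>
      rw [uSeq_succ]
      refine mul_nonneg hc (Finset.sum_nonneg fun j hj => mul_nonneg (ih _ (by omega)) (hq _))

lemma uSeq_sum (θ : ℝ) (hθ : 0 < θ) (q : ℕ → ℝ) (hq : ∀ n, 0 ≤ q n)
    (hs : ∀ N, ∑ j ∈ Finset.range N, q j ≤ θ / 2) (N : ℕ) :
    ∑ n ∈ Finset.range N, uSeq θ⁻¹ q n ≤ 2 := by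
  induction N using Nat.strong_induction_on with
  | _ N ih =>
    cases N with
    | zero => simp
    | succ N =>
      rw [Finset.sum_range_succ', uSeq_zero]
      simp only [uSeq_succ]
      rw [← Finset.mul_sum]
      rw [Finset.sum_range_diag_flip N (fun k l => uSeq θ⁻¹ q l * q (k + 1))]
      have h1 : ∑ m ∈ Finset.range N, ∑ k ∈ Finset.range (N - m), uSeq θ⁻¹ q k * q (m + 1)
          ≤ ∑ m ∈ Finset.range N, 2 * q (m + 1) := by
        refine Finset.sum_le_sum fun m hm => ?_
        rw [← Finset.sum_mul]
        exact mul_le_mul_of_nonneg_right (ih _ (by omega)) (hq _)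
      rw [← Finset.mul_sum] at h1
      have h2 := hs (N + 1)
      rw [Finset.sum_range_succ'] at h2
      have h3 := hq 0
      have h4 : θ⁻¹ * ∑ m ∈ Finset.range N, ∑ k ∈ Finset.range (N - m), uSeq θ⁻¹ q k * q (m + 1)
          ≤ θ⁻¹ * θ := mul_le_mul_of_nonneg_left (by linarith) (by positivity)
      rw [inv_mul_cancel₀ hθ.ne'] at h4
      linarith

/-- The slowly varying summable sequence. -/
noncomputable def aSeq (r : ℝ) (u : ℕ → ℝ) : ℕ → ℝ
  | 0 => u 0
  | n + 1 => r * aSeq r u n + u (n + 1)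

lemma exists_aSeq (θ r : ℝ) (hθ : 0 < θ) (hr : 0 < r) (hr1 : r < 1) (q : ℕ → ℝ)
    (hq : ∀ n, 0 ≤ q n) (hq0 : q 0 = 0)
    (hs : ∀ N, ∑ j ∈ Finset.range N, q j ≤ θ / 2) :
    ∃ a : ℕ → ℝ, a 0 = 1 ∧ (∀ n, 0 < a n) ∧ (∀ n, r * a n ≤ a (n + 1)) ∧ Summable a ∧
      ∀ y, ∑ j ∈ Finset.range (y + 1), a (y - j) * q j ≤ θ * a y := by
  have hu := uSeq_nonneg θ⁻¹ (by positivity) q hq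
  have hus := uSeq_sum θ hθ q hq hs
  have hu0 := uSeq_zero θ⁻¹ q
  have huc : ∀ y, ∑ j ∈ Finset.range (y + 2), uSeq θ⁻¹ q (y + 1 - j) * q j
      = θ * uSeq θ⁻¹ q (y + 1) := by
    intro y
    rw [Finset.sum_range_succ', hq0, uSeq_succ, ← mul_assoc, mul_inv_cancel₀ hθ.ne']
    simp
  generalize uSeq θ⁻¹ q = u at *
  have ha : ∀ n, 0 < aSeq r u n := by
    intro n
    induction n with
    | zero => rw [aSeq, hu0]; norm_num
    | succ n ih => rw [aSeq]; have := hu (n + 1); positivity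
  refine ⟨aSeq r u, by rw [aSeq, hu0], ha, fun n => ?_, ?_, ?_⟩
  · rw [aSeq]; linarith [hu (n + 1)]
  · refine summable_of_sum_range_le (c := 2 / (1 - r)) (fun n => (ha n).le) fun N => ?_
    have h1r : 0 < 1 - r := by linarith
    induction N with
    | zero => simp; positivity
    | succ N ih =>
      have h := hus (N + 1)
      rw [Finset.sum_range_succ'] at h ⊢
      simp only [aSeq]
      rw [Finset.sum_add_distrib, ← Finset.mul_sum]
      have : 2 / (1 - r) = r * (2 / (1 - r)) + 2 := by field_simp; ring
      rw [this]
      have := mul_le_mul_of_nonneg_left ih hr.le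
      linarith
  · intro y
    induction y with
    | zero => simp [hq0]; have := ha 0; positivity
    | succ y ih =>
      have : ∑ j ∈ Finset.range (y + 1 + 1), aSeq r u (y + 1 - j) * q j
          = r * ∑ j ∈ Finset.range (y + 1), aSeq r u (y - j) * q j
            + ∑ j ∈ Finset.range (y + 2), u (y + 1 - j) * q j := by
        rw [Finset.sum_range_succ _ (y + 1), Finset.sum_range_succ _ (y + 1), Finset.mul_sum,
          ← add_assoc, ← Finset.sum_add_distrib]
        congr 1
        · refine Finset.sum_congr rfl fun j hj => ?_
          have hj' : y + 1 - j = (y - j) + 1 := by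
            have := Finset.mem_range.1 hj; omega
          rw [hj', aSeq]; ring
        · simp [aSeq]
      rw [this, huc, aSeq]
      have := mul_le_mul_of_nonneg_left ih hr.le
      linarith

lemma H_anti (a H : ℕ → ℝ) (ha : ∀ n, 0 < a n) (hH : ∀ y, H y = a y + H (y + 1)) :
    Antitone H := antitone_nat_of_succ_le fun n => by linarith [hH n, ha n]

lemma a_pow (a : ℕ → ℝ) (r : ℝ) (hr : 0 < r)
    (har : ∀ n, r * a n ≤ a (n + 1)) (y k : ℕ) : r ^ k * a y ≤ a (y + k) := by
  induction k with
  | zero => simp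
  | succ k ih =>
    have := har (y + k)
    have h2 := mul_le_mul_of_nonneg_left ih hr.le
    rw [pow_succ']; rw [← add_assoc]; linarith

lemma H_up (a H : ℕ → ℝ) (r : ℝ) (hr : 0 < r) (hr1 : r < 1) (ha : ∀ n, 0 < a n)
    (har : ∀ n, r * a n ≤ a (n + 1)) (hH : ∀ y, H y = a y + H (y + 1)) (L y k : ℕ)
    (hk : k ≤ L) : H (y + k) ≤ H y - r ^ L * a y * k := by
  induction k with
  | zero => simp
  | succ k ih =>
    have h1 := ih (by omega)
    have h2 := hH (y + k)
    have h3 := a_pow a r hr har y k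
    have h4 : r ^ L * a y ≤ r ^ k * a y :=
      mul_le_mul_of_nonneg_right (pow_le_pow_of_le_one hr.le hr1.le (by omega)) (ha y).le
    push_cast
    rw [← add_assoc]
    linarith

lemma H_down (a H : ℕ → ℝ) (hH : ∀ y, H y = a y + H (y + 1)) (y k : ℕ) :
    H (y - k) = H y + ∑ j ∈ Finset.range y, a (y - 1 - j) * (if j < k then 1 else 0) := by
  induction k with
  | zero => simp
  | succ k ih =>
    by_cases hk : k < y
    · have h1 := hH (y - (k + 1))
      have h2 : y - (k + 1) + 1 = y - k := by omega
      rw [h2, ih] at h1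
      rw [h1]
      have h3 : ∀ j, a (y - 1 - j) * (if j < k + 1 then (1 : ℝ) else 0)
          = a (y - 1 - j) * (if j < k then 1 else 0) + (if j = k then a (y - 1 - j) else 0) := by
        intro j
        rcases lt_trichotomy j k with h | h | h
        · simp [h, h.ne, show j < k + 1 by omega]
        · simp [h]
        · simp [h.ne', show ¬ j < k + 1 by omega, show ¬ j < k by omega]
      simp only [h3]
      rw [Finset.sum_add_distrib, Finset.sum_ite_eq' (Finset.range y) k, if_pos (by simpa using hk),
        show y - 1 - k = y - (k + 1) by omega]
      ring
    · have h2 : y - (k + 1) = y - k := by omega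
      rw [h2, ih]
      congr 1
      refine Finset.sum_congr rfl fun j hj => ?_
      have := Finset.mem_range.1 hj
      rw [if_pos (by omega), if_pos (by omega)]

lemma pointwise (a H : ℕ → ℝ) (r : ℝ) (hr : 0 < r) (hr1 : r < 1) (ha : ∀ n, 0 < a n)
    (har : ∀ n, r * a n ≤ a (n + 1)) (hH : ∀ y, H y = a y + H (y + 1)) (L J : ℕ)
    (M : ℝ) (hM : 0 ≤ M) (hML : M ≤ L) (i x z : ℕ) (hix : i ≤ x) :
    H (z - i) ≤ H (x - i) - r ^ L * a (x - i) * (if (z : ℝ) - x ≤ M then (z : ℝ) - x else 0)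
      - r ^ L * a (x - i) * (∑ j ∈ Finset.range J, if z + j + 1 ≤ x then (1 : ℝ) else 0)
      + ∑ j ∈ Finset.range (x - i), a (x - i - 1 - j) * (if z + j + 1 ≤ x then (1 : ℝ) else 0) := by
  have hA : 0 < r ^ L * a (x - i) := mul_pos (pow_pos hr _) (ha _)
  rcases le_or_gt x z with h | h
  · obtain ⟨k, rfl⟩ := Nat.exists_eq_add_of_le h
    have h0 : ∀ j, ¬ (x + k + j + 1 ≤ x) := fun j => by omega
    simp only [h0, if_false, Finset.sum_const_zero, mul_zero, sub_zero, add_zero]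
    rw [show x + k - i = x - i + k by omega]
    push_cast
    rw [add_sub_cancel_left]
    split_ifs with hk
    · exact H_up a H r hr hr1 ha har hH L _ _ (by exact_mod_cast hk.trans hML)
    · simpa using H_anti a H ha hH (Nat.le_add_right (x - i) k)
  · obtain ⟨k, rfl⟩ := Nat.exists_eq_add_of_le h.le
    have h0 : ∀ j, (z + j + 1 ≤ z + k) ↔ j < k := fun j => by omega
    simp only [h0]
    have h1 := H_down a H hH (z + k - i) k
    rw [show z + k - i - k = z - i by omega] at h1
    rw [h1, if_pos (by push_cast; have : (0 : ℝ) ≤ k := Nat.cast_nonneg k; linarith)]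
    have h2 : (∑ j ∈ Finset.range J, if j < k then (1 : ℝ) else 0) ≤ k := by
      rw [← Finset.sum_filter]
      simp only [Finset.sum_const, nsmul_eq_mul, mul_one, Nat.cast_le]
      calc _ ≤ (Finset.range k).card := Finset.card_le_card (fun j hj => by simp at hj ⊢; omega)
        _ = k := by simp
    have h3 := mul_le_mul_of_nonneg_left h2 hA.le
    push_cast
    linarith

lemma sum_bound (a q p : ℕ → ℝ) (r θ : ℝ) (hr : 0 < r) (hr1 : r < 1) (ha : ∀ n, 0 < a n)
    (har : ∀ n, r * a n ≤ a (n + 1)) (J y : ℕ) (hp : ∀ j, 0 ≤ p j)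
    (hpq : ∀ j, p j ≤ q (j + 1))
    (hconv : ∑ j ∈ Finset.range (y + 1), a (y - j) * (if J < j then q j else 0) ≤ θ * a y) :
    ∑ j ∈ Finset.range y, a (y - 1 - j) * p j
      ≤ a y * (r⁻¹) ^ J * (∑ j ∈ Finset.range J, p j) + θ * a y := by
  rw [Finset.sum_range_succ'] at hconv
  simp only [Nat.not_lt_zero, if_false, mul_zero, add_zero] at hconv
  have hq : ∀ j, 0 ≤ q (j + 1) := fun j => (hp j).trans (hpq j)
  have key : ∀ j ∈ Finset.range y, a (y - 1 - j) * p j ≤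
      (if j < J then a y * (r⁻¹) ^ J * p j else 0)
        + a (y - (j + 1)) * (if J < j + 1 then q (j + 1) else 0) := by
    intro j hj
    have hj := Finset.mem_range.1 hj
    rw [show y - 1 - j = y - (j + 1) by omega]
    by_cases h : j < J
    · rw [if_pos h, if_neg (by omega), mul_zero, add_zero]
      refine mul_le_mul_of_nonneg_right ?_ (hp j)
      have h1 := a_pow a r hr har (y - (j + 1)) (j + 1)
      rw [show y - (j + 1) + (j + 1) = y by omega] at h1
      have h2 : r ^ J * a (y - (j + 1)) ≤ r ^ (j + 1) * a (y - (j + 1)) :=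
        mul_le_mul_of_nonneg_right (pow_le_pow_of_le_one hr.le hr1.le (by omega)) (ha _).le
      have h3 : 0 < r ^ J := pow_pos hr _
      rw [inv_pow, ← div_eq_mul_inv, le_div_iff₀ h3]
      linarith
    · rw [if_neg h, if_pos (by omega), zero_add]
      exact mul_le_mul_of_nonneg_left (hpq j) (ha _).le
  refine (Finset.sum_le_sum key).trans ?_
  rw [Finset.sum_add_distrib]
  refine add_le_add ?_ hconv
  rw [← Finset.sum_filter, Finset.mul_sum]
  refine Finset.sum_le_sum_of_subset_of_nonneg (fun j hj => by simp at hj ⊢; omega) ?_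
  intro j _ _
  exact mul_nonneg (mul_nonneg (ha y).le (by positivity)) (hp j)

lemma exists_r (ε : ℝ) (hε : 0 < ε) (L J : ℕ) :
    ∃ r : ℝ, 0 < r ∧ r < 1 ∧ 3 / 4 ≤ r ^ L ∧ ((r⁻¹) ^ J - r ^ L) * J ≤ ε / 4 := by
  have h1 : ContinuousAt (fun r : ℝ => r ^ L) 1 := by fun_prop
  have h2 : ContinuousAt (fun r : ℝ => ((r⁻¹) ^ J - r ^ L) * J) 1 := by
    have : ContinuousAt (fun r : ℝ => r⁻¹) 1 := continuousAt_inv₀ one_ne_zero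
    fun_prop
  have e1 : ∀ᶠ r in 𝓝 (1 : ℝ), 3 / 4 < r ^ L := h1.eventually (lt_mem_nhds (by norm_num))
  have e2 : ∀ᶠ r in 𝓝 (1 : ℝ), ((r⁻¹) ^ J - r ^ L) * J < ε / 4 :=
    h2.eventually (gt_mem_nhds (by simp; linarith))
  have e3 : ∀ᶠ r in 𝓝 (1 : ℝ), 0 < r := lt_mem_nhds (by norm_num)
  have e : ∀ᶠ r in 𝓝[<] (1 : ℝ), (3 / 4 < r ^ L ∧ ((r⁻¹) ^ J - r ^ L) * J < ε / 4 ∧ 0 < r) ∧ r < 1 :=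
    ((e1.and (e2.and e3)).filter_mono nhdsWithin_le_nhds).and self_mem_nhdsWithin
  obtain ⟨r, ⟨ha, hb, hc⟩, hd⟩ := e.exists
  exact ⟨r, hc, hd, ha.le, hb.le⟩

lemma tail_summable (ν : Measure ℕ) [IsProbabilityMeasure ν]
    (hζ : (∫⁻ x, (x : ℝ≥0∞) ∂ν) < ∞) :
    Summable fun j : ℕ => (ν {x | j ≤ x}).toReal := by
  rw [← summable_nat_add_iff 1]
  refine ENNReal.summable_toReal ?_
  have h : ∑' j : ℕ, ν {x | j + 1 ≤ x} = ∫⁻ x, (x : ℝ≥0∞) ∂ν := by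
    have h1 : ∀ j : ℕ, ν {x | j + 1 ≤ x} = ∫⁻ x, (if j < x then 1 else 0) ∂ν := by
      intro j
      rw [← lintegral_indicator_one (by measurability)]
      refine lintegral_congr fun x => ?_
      simp [Set.indicator_apply, Nat.succ_le_iff]
    simp_rw [h1]
    rw [← lintegral_tsum (fun j => (measurable_of_countable _).aemeasurable)]
    refine lintegral_congr fun x => ?_
    rw [tsum_eq_sum (s := Finset.range x) (by intro j hj; simpa using hj)]
    rw [← Finset.sum_filter]
    simp [Finset.filter_true_of_mem]
  rw [h]; exact hζ.ne

lemma tail_cut (q : ℕ → ℝ) (hq : ∀ n, 0 ≤ q n) (hs : Summable q) (d : ℝ) (hd : 0 < d) :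
    ∃ J : ℕ, ∀ N, ∑ j ∈ Finset.range N, (if J < j then q j else 0) ≤ d := by
  have h := tendsto_sum_nat_add q
  obtain ⟨J, hJ⟩ := (h.eventually (gt_mem_nhds hd)).exists
  refine ⟨J, fun N => ?_⟩
  have hs' : Summable fun k => q (k + J) := (summable_nat_add_iff J).2 hs
  have h1 : ∑ j ∈ Finset.range N, (if J < j then q j else 0)
      ≤ ∑ j ∈ Finset.range (J + N), (if J < j then q j else 0) :=
    Finset.sum_le_sum_of_subset_of_nonneg (by simp)
      (fun j _ _ => by split_ifs; exacts [hq j, le_rfl])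
  rw [Finset.sum_range_add] at h1
  have h2 : ∑ j ∈ Finset.range J, (if J < j then q j else 0) = 0 :=
    Finset.sum_eq_zero fun j hj => if_neg (by have := Finset.mem_range.1 hj; omega)
  have h3 : ∑ k ∈ Finset.range N, (if J < J + k then q (J + k) else 0)
      ≤ ∑ k ∈ Finset.range N, q (k + J) :=
    Finset.sum_le_sum fun k _ => by
      rw [add_comm J k]; split_ifs; exacts [le_rfl, hq _]
  have h4 := hs'.sum_le_tsum (Finset.range N) (fun k _ => hq _)
  linarith

lemma MC.lintegral_shift (X : MC) (i : ℕ) (f : (ℕ → ℕ) → ℝ≥0∞) (hf : Measurable f) :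
    ∫⁻ ω, f (fun n => ω (n + 1)) ∂(X.μ i) = ∑' j, X.P i j * ∫⁻ ω, f ω ∂(X.μ j) := by
  have hm : Measurable (fun (ω : ℕ → ℕ) n => ω (n + 1)) := by fun_prop
  rw [← lintegral_map hf hm, X.markov, lintegral_sum_measure]
  simp

lemma MC.ae_start (X : MC) (i : ℕ) : ∀ᵐ ω ∂(X.μ i), ω 0 = i := by
  have := X.prob i
  have hm : MeasurableSet {ω : ℕ → ℕ | ω 0 = i} :=
    measurableSet_eq_fun (measurable_pi_apply 0) measurable_const
  exact (mem_ae_iff_prob_eq_one hm).2 (X.start i)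

lemma MC.lintegral_one (X : MC) (i : ℕ) (f : ℕ → ℝ≥0∞) :
    ∫⁻ ω, f (ω 1) ∂(X.μ i) = ∑' j, X.P i j * f j := by
  have h := X.lintegral_shift i (fun ω => f (ω 0))
    ((measurable_of_countable f).comp (measurable_pi_apply 0))
  simp only [zero_add] at h
  rw [h]
  refine tsum_congr fun j => ?_
  have := X.prob j
  have h2 : ∫⁻ ω, f (ω 0) ∂(X.μ j) = ∫⁻ ω, f j ∂(X.μ j) :=
    lintegral_congr_ae ((X.ae_start j).mono fun ω hω => by simp [hω])
  rw [h2]; simp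

lemma MC.prod_bound (X : MC) (w V : ℕ → ℝ≥0∞) (hV1 : ∀ x, 1 ≤ V x)
    (hV : ∀ x, w x * ∫⁻ ω, V (ω 1) ∂(X.μ x) ≤ V x) (N x : ℕ) :
    ∫⁻ ω, ∏ n ∈ Finset.range N, w (ω n) ∂(X.μ x) ≤ V x := by
  have hw : ∀ n, Measurable fun ω : ℕ → ℕ => w (ω n) := fun n =>
    (measurable_of_countable w).comp (measurable_pi_apply n)
  induction N generalizing x with
  | zero => have := X.prob x; simpa using hV1 x
  | succ N ih =>
    have hm : Measurable fun ω : ℕ → ℕ => ∏ n ∈ Finset.range N, w (ω n) :=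
      Finset.measurable_fun_prod _ fun n _ => hw n
    have h1 : ∫⁻ ω, ∏ n ∈ Finset.range (N + 1), w (ω n) ∂(X.μ x)
        = ∫⁻ ω, w x * ∏ n ∈ Finset.range N, w (ω (n + 1)) ∂(X.μ x) :=
      lintegral_congr_ae ((X.ae_start x).mono fun ω hω => by
        simp only
        rw [Finset.prod_range_succ', hω, mul_comm])
    have hm' : Measurable fun ω : ℕ → ℕ => ∏ n ∈ Finset.range N, w (ω (n + 1)) :=
      Finset.measurable_fun_prod _ fun n _ => hw (n + 1)
    rw [h1, lintegral_const_mul _ hm', X.lintegral_shift x _ hm]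
    refine le_trans ?_ (hV x)
    rw [X.lintegral_one]
    gcongr with j
    exact ih j

lemma tprod_eq_iSup (f : ℕ → ℝ≥0∞) (hf : ∀ n, 1 ≤ f n) :
    ∏' n, f n = ⨆ N, ∏ n ∈ Finset.range N, f n := by
  have hmono : Monotone fun s : Finset ℕ => ∏ n ∈ s, f n := fun s t hst =>
    Finset.prod_le_prod_of_subset_of_one_le' hst (fun n _ _ => hf n)
  have h : HasProd f (⨆ s : Finset ℕ, ∏ n ∈ s, f n) := tendsto_atTop_iSup hmono
  have h2 := h.tendsto_prod_nat
  have h3 : Tendsto (fun N => ∏ n ∈ Finset.range N, f n) atTop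
      (𝓝 (⨆ N, ∏ n ∈ Finset.range N, f n)) :=
    tendsto_atTop_iSup (hmono.comp Finset.range_mono)
  rw [h.tprod_eq]
  exact tendsto_nhds_unique h2 h3

lemma MC.tprod_bound (X : MC) (w V : ℕ → ℝ≥0∞) (hw1 : ∀ x, 1 ≤ w x) (hV1 : ∀ x, 1 ≤ V x)
    (hV : ∀ x, w x * ∫⁻ ω, V (ω 1) ∂(X.μ x) ≤ V x) (x : ℕ) :
    ∫⁻ ω, ∏' n, w (ω n) ∂(X.μ x) ≤ V x := by
  simp_rw [fun ω : ℕ → ℕ => tprod_eq_iSup (fun n => w (ω n)) (fun n => hw1 _)]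
  rw [lintegral_iSup]
  · exact iSup_le fun N => X.prod_bound w V hV1 hV N x
  · exact fun N => Finset.measurable_fun_prod _ fun n _ =>
      (measurable_of_countable w).comp (measurable_pi_apply n)
  · intro N N' h ω
    exact Finset.prod_le_prod_of_subset_of_one_le' (Finset.range_mono h) (fun n _ _ => hw1 _)

theorem stmt12 (X : MC) (ε M : ℝ) (hε : 0 < ε)
    (hdint : ∀ i : ℕ, Integrable
      (fun ω => if (ω 1 : ℝ) - (i : ℝ) ≤ M then (ω 1 : ℝ) - (i : ℝ) else 0) (X.μ i))
    (hdrift : ∀ i : ℕ,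
      ε ≤ ∫ ω, (if (ω 1 : ℝ) - (i : ℝ) ≤ M then (ω 1 : ℝ) - (i : ℝ) else 0) ∂(X.μ i))
    (ν : Measure ℕ) [IsProbabilityMeasure ν]
    (hζ : (∫⁻ x, (x : ℝ≥0∞) ∂ν) < ∞)
    (htail : ∀ i j : ℕ,
      X.μ i {ω | (ω 1 : ℤ) - (i : ℤ) ≤ -(j : ℤ)} ≤ ν {x | j ≤ x}) :
    ∃ γ > (0 : ℝ), (⨆ i, ∫⁻ ω, locExp γ i ω ∂(X.μ i)) < ∞ := by
  have hM : 0 ≤ M := by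
    by_contra hM
    push Not at hM
    have := hdrift 0
    have h2 : ∫ ω, (if (ω 1 : ℝ) - ((0 : ℕ) : ℝ) ≤ M then (ω 1 : ℝ) - ((0 : ℕ) : ℝ) else 0) ∂(X.μ 0)
        ≤ 0 := by
      refine integral_nonpos fun ω => ?_
      simp only [Pi.zero_apply]
      split_ifs <;> linarith
    linarith
  obtain ⟨L, hL⟩ := exists_nat_ge M
  set q : ℕ → ℝ := fun j => (ν {x | j ≤ x}).toReal with hqdef
  have hq0 : ∀ j, 0 ≤ q j := fun j => ENNReal.toReal_nonneg
  obtain ⟨J, hJ⟩ := tail_cut q hq0 (tail_summable ν hζ) (ε / 4 / 2) (by positivity)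
  obtain ⟨r, hr, hr1, hrL, hrJ⟩ := exists_r ε hε L J
  obtain ⟨a, ha0, ha, har, has, hconv⟩ := exists_aSeq (ε / 4) r (by positivity) hr hr1
    (fun j => if J < j then q j else 0) (fun j => by split_ifs; exacts [hq0 j, le_rfl])
    (by simp) hJ
  set H : ℕ → ℝ := fun y => ∑' k, a (k + y) with hHdef
  have hH : ∀ y, H y = a y + H (y + 1) := by
    intro y
    have : Summable fun k => a (k + y) := (summable_nat_add_iff y).2 has
    simp only [hHdef]
    rw [this.tsum_eq_zero_add]
    rw [zero_add]
    congr 1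
    refine tsum_congr fun k => ?_
    congr 1; ring
  have hHnn : ∀ y, 0 ≤ H y := fun y => tsum_nonneg fun k => (ha _).le
  have hanti := H_anti a H ha hH
  have hHint : ∀ x i : ℕ, Integrable (fun ω : ℕ → ℕ => H (ω 1 - i)) (X.μ x) := by
    intro x i
    have := X.prob x
    refine Integrable.of_bound (C := H 0)
      ((measurable_of_countable (fun n => H (n - i))).comp
        (measurable_pi_apply 1)).aestronglyMeasurable (ae_of_all _ fun ω => ?_)
    rw [Real.norm_of_nonneg (hHnn _)]
    exact hanti (Nat.zero_le _)
  have hdr : ∀ i x : ℕ, i ≤ x →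
      ∫ ω, H (ω 1 - i) ∂(X.μ x) ≤ H (x - i) - ε / 4 * a (x - i) := by
    intro i x hix
    have := X.prob x
    set s : ℕ → (ℕ → ℕ) → ℝ := fun j ω => if ω 1 + j + 1 ≤ x then (1 : ℝ) else 0 with hs
    set p : ℕ → ℝ := fun j => ∫ ω, s j ω ∂(X.μ x) with hp
    have hsint : ∀ j, Integrable (s j) (X.μ x) := by
      intro j
      refine Integrable.of_bound (C := 1)
        ((measurable_of_countable (fun n : ℕ => if n + j + 1 ≤ x then (1 : ℝ) else 0)).comp
          (measurable_pi_apply 1)).aestronglyMeasurable (ae_of_all _ fun ω => ?_)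
      simp only [hs]; split_ifs <;> simp
    have hp0 : ∀ j, 0 ≤ p j := fun j => integral_nonneg fun ω => by
      simp only [hs, Pi.zero_apply]; split_ifs <;> norm_num
    have hpm : ∀ j, p j = (X.μ x {ω | ω 1 + j + 1 ≤ x}).toReal := by
      intro j
      have hmeas : MeasurableSet {ω : ℕ → ℕ | ω 1 + j + 1 ≤ x} :=
        measurableSet_le ((measurable_of_countable (fun n : ℕ => n + j + 1)).comp
          (measurable_pi_apply 1)) measurable_const
      have := integral_indicator_one (μ := X.μ x) hmeas
      rw [measureReal_def] at this
      rw [← this]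
      refine integral_congr_ae (ae_of_all _ fun ω => ?_)
      simp [hs, Set.indicator_apply]
    have hp1 : ∀ j, p j ≤ 1 := fun j => by
      rw [hpm]; exact ENNReal.toReal_le_of_le_ofReal zero_le_one (by simpa using prob_le_one)
    have hpq : ∀ j, p j ≤ q (j + 1) := by
      intro j
      rw [hpm]
      refine ENNReal.toReal_mono (measure_ne_top _ _) ?_
      refine le_trans (measure_mono fun ω hω => ?_) (htail x (j + 1))
      simp only [Set.mem_ofPred_eq] at hω ⊢
      push_cast; omega
    have hsum : ∑ j ∈ Finset.range J, p j ≤ J := by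
      simpa using Finset.sum_le_sum (s := Finset.range J) (fun j _ => hp1 j)
    have hsum0 : 0 ≤ ∑ j ∈ Finset.range J, p j := Finset.sum_nonneg fun j _ => hp0 j
    have hb := sum_bound a q p r (ε / 4) hr hr1 ha har J (x - i) hp0 hpq (hconv _)
    set A := r ^ L * a (x - i) with hA
    set T : (ℕ → ℕ) → ℝ := fun ω => if (ω 1 : ℝ) - (x : ℝ) ≤ M then (ω 1 : ℝ) - (x : ℝ) else 0
      with hT
    have hTint : Integrable T (X.μ x) := hdint x
    have hTd : ε ≤ ∫ ω, T ω ∂(X.μ x) := hdrift x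
    have hS1 : Integrable (fun ω => ∑ j ∈ Finset.range J, s j ω) (X.μ x) :=
      integrable_finsetSum _ fun j _ => hsint j
    have hS2 : Integrable (fun ω => ∑ j ∈ Finset.range (x - i), a (x - i - 1 - j) * s j ω)
        (X.μ x) := integrable_finsetSum _ fun j _ => (hsint j).const_mul _
    have hint : ∫ ω, H (ω 1 - i) ∂(X.μ x) ≤
        ∫ ω, (H (x - i) - A * T ω - A * (∑ j ∈ Finset.range J, s j ω)
          + ∑ j ∈ Finset.range (x - i), a (x - i - 1 - j) * s j ω) ∂(X.μ x) := by
      refine integral_mono (hHint x i) ?_ fun ω => ?_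
      · exact (((integrable_const _).sub (hTint.const_mul _)).sub (hS1.const_mul _)).add hS2
      · exact pointwise a H r hr hr1 ha har hH L J M hM hL i x (ω 1) hix
    have hI0 : Integrable (fun _ : ℕ → ℕ => H (x - i)) (X.μ x) := integrable_const _
    have hI1 : Integrable (fun ω => A * T ω) (X.μ x) := hTint.const_mul _
    have hI2 : Integrable (fun ω => A * ∑ j ∈ Finset.range J, s j ω) (X.μ x) := hS1.const_mul _
    have hI3 : Integrable (fun ω => H (x - i) - A * T ω) (X.μ x) := hI0.sub hI1
    have hI4 : Integrable (fun ω => H (x - i) - A * T ω - A * ∑ j ∈ Finset.range J, s j ω)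
      (X.μ x) := hI3.sub hI2
    rw [integral_add hI4 hS2, integral_sub hI3 hI2, integral_sub hI0 hI1, integral_const_mul,
      integral_const_mul, integral_finsetSum _ (fun j _ => hsint j),
      integral_finsetSum _ (fun j _ => (hsint j).const_mul _)] at hint
    simp only [integral_const_mul, integral_const, probReal_univ, one_smul] at hint
    have hA0 : 0 < A := mul_pos (pow_pos hr _) (ha _)
    have h1 := mul_le_mul_of_nonneg_left hTd hA0.le
    have hay := ha (x - i)
    have h2 : ((r⁻¹) ^ J - r ^ L) * (∑ j ∈ Finset.range J, p j) ≤ ε / 4 := by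
      refine le_trans (mul_le_mul_of_nonneg_left hsum ?_) hrJ
      have e1 : 1 ≤ (r⁻¹) ^ J := one_le_pow₀ (one_le_inv_iff₀.2 ⟨hr, hr1.le⟩)
      have e2 : r ^ L ≤ 1 := pow_le_one₀ hr.le hr1.le
      linarith
    have h3 := mul_le_mul_of_nonneg_left h2 hay.le
    have h4 : 3 / 4 * a (x - i) * ε ≤ A * ε :=
      mul_le_mul_of_nonneg_right (mul_le_mul_of_nonneg_right hrL hay.le) hε.le
    have h5 : ∫ ω, H (ω 1 - i) ∂(X.μ x) ≤ H (x - i) - A * (∫ ω, T ω ∂(X.μ x))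
      - A * (∑ j ∈ Finset.range J, p j) + ∑ j ∈ Finset.range (x - i), a (x - i - 1 - j) * p j := hint
    have h6 : A * (∑ j ∈ Finset.range J, p j) = a (x - i) * (r ^ L * ∑ j ∈ Finset.range J, p j) := by
      rw [hA]; ring
    have h7 : a (x - i) * (((r⁻¹) ^ J - r ^ L) * (∑ j ∈ Finset.range J, p j)) =
      a (x - i) * (r⁻¹) ^ J * (∑ j ∈ Finset.range J, p j)
        - a (x - i) * (r ^ L * ∑ j ∈ Finset.range J, p j) := by ring
    nlinarith
  set K := 1 + H 0 with hK
  have hK1 : 1 ≤ K := by have := hHnn 0; linarith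
  set t := ε / 4 / K with ht
  have ht0 : 0 < t := by positivity
  refine ⟨Real.log (1 + t), Real.log_pos (by linarith), ?_⟩
  refine lt_of_le_of_lt (iSup_le fun i => ?_) (ENNReal.ofReal_lt_top (r := K))
  have hexp : Real.exp (Real.log (1 + t)) = 1 + t := Real.exp_log (by linarith)
  have hfin := X.tprod_bound
    (fun x => if x = i then ENNReal.ofReal (Real.exp (Real.log (1 + t))) else 1)
    (fun x => ENNReal.ofReal (1 + H (x - i))) ?_ ?_ ?_ i
  · simp only [locExp]
    simpa [hK] using hfin
  · intro x
    split_ifs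
    · rw [hexp, ENNReal.one_le_ofReal]; linarith
    · exact le_rfl
  · intro x
    rw [ENNReal.one_le_ofReal]; linarith [hHnn (x - i)]
  · intro x
    have := X.prob x
    have hi : Integrable (fun ω : ℕ → ℕ => 1 + H (ω 1 - i)) (X.μ x) :=
      (integrable_const _).add (hHint x i)
    rw [← ofReal_integral_eq_lintegral_ofReal hi
      (ae_of_all _ fun ω => by have := hHnn (ω 1 - i); simp only [Pi.zero_apply]; linarith),
      integral_add (integrable_const _) (hHint x i)]
    simp only [integral_const, probReal_univ, one_smul]
    by_cases hx : x = i
    · subst hx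
      rw [if_pos rfl, hexp, ← ENNReal.ofReal_mul (by linarith)]
      refine ENNReal.ofReal_le_ofReal ?_
      have h := hdr x x le_rfl
      rw [Nat.sub_self, ha0] at h
      rw [Nat.sub_self]
      have htK : t * K = ε / 4 := by rw [ht]; field_simp
      calc (1 + t) * (1 + ∫ ω, H (ω 1 - x) ∂(X.μ x)) ≤ (1 + t) * (K - t * K) :=
            mul_le_mul_of_nonneg_left (by linarith) (by linarith)
        _ = K - t ^ 2 * K := by ring
        _ ≤ 1 + H 0 := by have : 0 ≤ t ^ 2 * K := by positivity
                          linarith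
    · rw [if_neg hx, one_mul]
      refine ENNReal.ofReal_le_ofReal ?_
      rcases le_or_gt i x with h | h
      · have h1 := hdr i x h
        have h2 : 0 < ε / 4 * a (x - i) := mul_pos (by positivity) (ha _)
        linarith
      · have : ∫ ω, H (ω 1 - i) ∂(X.μ x) ≤ ∫ ω, H 0 ∂(X.μ x) :=
          integral_mono (hHint x i) (integrable_const _) fun ω => hanti (Nat.zero_le _)
        simp only [integral_const, probReal_univ, one_smul] at this
        rw [show x - i = 0 by omega]
        linarith
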